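/- arXiv:1712.09647 — 2 statements merged into one kernel-verified Lean document; each statement's English description precedes it below -/
import Mathlib

section
/- Let 𝓕 be a Kalton space on U with values in Σ, let s, t ∈ U and let n ∈ ℕ ∪ {0}. Then the gap, computed in the Banach space 𝓕, between the closed subspaces ⋂_{0 ≤ k ≤ n} ker δ_s^{(k)} and ⋂_{0 ≤ k ≤ n} ker δ_t^{(k)} (where δ_z^{(k)} f = f^{(k)}(z)) is at most 2(n+1)·h(s,t). -/
open Complex Metric Set

noncomputable section

/-- A conformal equivalence (analytic bijection) of `U` onto `V`. -/
def ConformalEquivOn (φ : ℂ → ℂ) (U V : Set ℂ) : Prop :=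
  DifferentiableOn ℂ φ U ∧ Set.BijOn φ U V

/-- A Kalton space of analytic functions on an open set `U ⊆ ℂ` conformally equivalent to the
open unit disc, with values in the complex Banach space `Sig`.  The Banach carrier is `F`, whose
elements are identified with analytic functions `ℂ → Sig` (only the restriction to `U` matters)
via the injective linear map `toFun`. -/
structure KaltonSpace (U : Set ℂ) (Sig : Type*) (F : Type*)
    [NormedAddCommGroup Sig] [NormedSpace ℂ Sig] [CompleteSpace Sig]
    [NormedAddCommGroup F] [NormedSpace ℂ F] [CompleteSpace F] where
  isOpen : IsOpen U
  conformal_exists : ∃ φ : ℂ → ℂ, ConformalEquivOn φ U (Metric.ball (0 : ℂ) 1)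
  toFun : F →ₗ[ℂ] (ℂ → Sig)
  inj : ∀ f g : F, Set.EqOn (toFun f) (toFun g) U → f = g
  analytic : ∀ f : F, DifferentiableOn ℂ (toFun f) U
  eval_bound : ∀ z ∈ U, ∃ C : ℝ, ∀ f : F, ‖toFun f z‖ ≤ C * ‖f‖
  conf_mul_mem : ∀ φ : ℂ → ℂ, ConformalEquivOn φ U (Metric.ball (0 : ℂ) 1) →
    ∀ f : F, ∃ g : F, (∀ z ∈ U, toFun g z = φ z • toFun f z) ∧ ‖g‖ = ‖f‖
  conf_div_mem : ∀ φ : ℂ → ℂ, ConformalEquivOn φ U (Metric.ball (0 : ℂ) 1) →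
    ∀ h : ℂ → Sig, DifferentiableOn ℂ h U →
    ∀ g : F, (∀ z ∈ U, toFun g z = φ z • h z) →
    ∃ f : F, (∀ z ∈ U, toFun f z = h z) ∧ ‖f‖ = ‖g‖

namespace KaltonSpace

variable {U : Set ℂ} {Sig F : Type*}
  [NormedAddCommGroup Sig] [NormedSpace ℂ Sig] [CompleteSpace Sig]
  [NormedAddCommGroup F] [NormedSpace ℂ F] [CompleteSpace F]

/-- `x` belongs to the interpolation space `X_z = {f z : f ∈ 𝓕}`. -/
def MemX (K : KaltonSpace U Sig F) (z : ℂ) (x : Sig) : Prop :=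
  ∃ f : F, K.toFun f z = x

/-- The quotient norm `‖x‖_z = inf {‖f‖ : f ∈ 𝓕, f z = x}` of `X_z`. -/
def normX (K : KaltonSpace U Sig F) (z : ℂ) (x : Sig) : ℝ :=
  sInf {r : ℝ | ∃ f : F, K.toFun f z = x ∧ r = ‖f‖}

/-- `B` is a homogeneous bounded selection for the evaluation `δ_z`, with constant `c`. -/
def IsSelection (K : KaltonSpace U Sig F) (z : ℂ) (c : ℝ) (B : Sig → F) : Prop :=
  (∀ (l : ℂ) (x : Sig), K.MemX z x → B (l • x) = l • B x) ∧
  (∀ x : Sig, K.MemX z x → K.toFun (B x) z = x) ∧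
  (∀ x : Sig, K.MemX z x → ‖B x‖ ≤ c * K.normX z x)

end KaltonSpace

/-- The gap `g(M,N)` between two subsets `M`, `N` of a (semi)normed space, computed with their
closed unit balls `B_M = M ∩ B(0,1)`, `B_N = N ∩ B(0,1)`. -/
def subGap {Z : Type*} [SeminormedAddCommGroup Z] (M N : Set Z) : ℝ :=
  max
    (sSup ((fun x => Metric.infDist x (N ∩ Metric.closedBall 0 1)) '' (M ∩ Metric.closedBall 0 1)))
    (sSup ((fun y => Metric.infDist y (M ∩ Metric.closedBall 0 1)) '' (N ∩ Metric.closedBall 0 1)))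

open Filter Topology ComplexConjugate

theorem deriv_ne_zero_of_injOn {φ : ℂ → ℂ} {U : Set ℂ} (hU : IsOpen U)
    (hφ : DifferentiableOn ℂ φ U) (hinj : InjOn φ U) {s : ℂ} (hs : s ∈ U) : deriv φ s ≠ 0 := by
  have han : AnalyticOnNhd ℂ φ U := hφ.analyticOnNhd hU
  have hnc : ∀ z ∈ U, ¬ ∀ᶠ w in 𝓝 z, φ w = φ z := by
    intro z hz h
    have h' : ∀ᶠ w in 𝓝 z, w = z := by
      filter_upwards [h, hU.mem_nhds hz] with w hw hwU using hinj hwU hz hw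
    obtain ⟨w, hw, hwz⟩ := ((h'.filter_mono nhdsWithin_le_nhds).and
      (self_mem_nhdsWithin : {z}ᶜ ∈ 𝓝[≠] z)).exists
    exact hwz hw
  have hopen : ∀ z ∈ U, 𝓝 (φ z) ≤ map φ (𝓝 z) := fun z hz =>
    ((han z hz).eventually_constant_or_nhds_le_map_nhds).resolve_left (hnc z hz)
  set g : ℂ → ℂ := Function.invFunOn φ U
  have hgl : ∀ z ∈ U, g (φ z) = z := fun z hz => hinj.leftInvOn_invFunOn hz
  have hgr : ∀ z ∈ U, ∀ᶠ w in 𝓝 (φ z), g w ∈ U ∧ φ (g w) = w := fun z hz => by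
    refine Eventually.filter_mono (hopen z hz) (eventually_map.2 ?_)
    filter_upwards [hU.mem_nhds hz] with y hy
    simp only [hgl y hy, hy, and_self]
  have hgc : ∀ z ∈ U, Tendsto g (𝓝 (φ z)) (𝓝 z) := fun z hz => by
    refine Tendsto.mono_left ?_ (hopen z hz)
    rw [tendsto_map'_iff]
    refine tendsto_id.congr' ?_
    filter_upwards [hU.mem_nhds hz] with y hy using (hgl y hy).symm
  have hd' : ∀ᶠ z in 𝓝[≠] s, deriv φ z ≠ 0 := by
    refine ((han s hs).deriv.eventually_eq_zero_or_eventually_ne_zero).resolve_left fun h => ?_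
    obtain ⟨r, hr, hball⟩ := Metric.eventually_nhds_iff_ball.1 (h.and (hU.mem_nhds hs))
    refine hnc s hs ?_
    filter_upwards [Metric.ball_mem_nhds s hr] with w hw
    exact isOpen_ball.is_const_of_deriv_eq_zero (convex_ball s r).isPreconnected
      (hφ.mono fun y hy => (hball y hy).2) (fun y hy => (hball y hy).1) hw (mem_ball_self hr)
  have hgne : ∀ᶠ w in 𝓝[≠] (φ s), DifferentiableAt ℂ g w := by
    have hne : Tendsto g (𝓝[≠] (φ s)) (𝓝[≠] s) := by
      refine tendsto_nhdsWithin_iff.2 ⟨(hgc s hs).mono_left nhdsWithin_le_nhds, ?_⟩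
      filter_upwards [(hgr s hs).filter_mono nhdsWithin_le_nhds, self_mem_nhdsWithin] with w hw hws
      rintro (rfl : g w = s)
      exact hws hw.2.symm
    have hev : ∀ᶠ w in 𝓝[≠] (φ s), ∀ᶠ v in 𝓝 w, g v ∈ U ∧ φ (g v) = v :=
      ((hgr s hs).eventually_nhds).filter_mono nhdsWithin_le_nhds
    filter_upwards [hne.eventually hd', hev] with w hw hev
    obtain ⟨hwU, hwe⟩ := hev.self_of_nhds
    have hcont : ContinuousAt g w := by
      have h := hgc (g w) hwU
      rwa [hwe] at h
    exact (HasDerivAt.of_local_left_inverse hcont (han _ hwU).differentiableAt.hasDerivAt hw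
      (hev.mono fun v hv => hv.2)).differentiableAt
  have hgd : DifferentiableAt ℂ g (φ s) :=
    (Complex.analyticAt_of_differentiable_on_punctured_nhds_of_continuousAt hgne
      (by rw [ContinuousAt, hgl s hs]; exact hgc s hs)).differentiableAt
  intro h0
  have hφs : HasDerivAt φ 0 s := h0 ▸ (han s hs).differentiableAt.hasDerivAt
  have hcomp : HasDerivAt (g ∘ φ) (deriv g (φ s) * 0) s := hgd.hasDerivAt.comp s hφs
  have hid : HasDerivAt (g ∘ φ) 1 s := by
    refine (hasDerivAt_id s).congr_of_eventuallyEq ?_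
    filter_upwards [hU.mem_nhds hs] with y hy using hgl y hy
  simpa using hcomp.unique hid

theorem one_sub_conj_mul_ne_zero {a w : ℂ} (ha : ‖a‖ < 1) (hw : ‖w‖ < 1) :
    1 - conj a * w ≠ 0 := by
  intro h
  have h1 : ‖conj a * w‖ = 1 := by rw [← sub_eq_zero.1 h, norm_one]
  rw [norm_mul, RCLike.norm_conj] at h1
  nlinarith [norm_nonneg a, norm_nonneg w]

theorem norm_sub_div_one_sub_conj_mul_lt_one {a w : ℂ} (ha : ‖a‖ < 1) (hw : ‖w‖ < 1) :
    ‖(w - a) / (1 - conj a * w)‖ < 1 := by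
  rw [norm_div, div_lt_one (norm_pos_iff.2 (one_sub_conj_mul_ne_zero ha hw))]
  refine lt_of_pow_lt_pow_left₀ 2 (norm_nonneg _) ?_
  have ha2 : ‖a‖ ^ 2 < 1 := by nlinarith [norm_nonneg a]
  have hw2 : ‖w‖ ^ 2 < 1 := by nlinarith [norm_nonneg w]
  rw [Complex.sq_norm, Complex.normSq_apply] at *
  rw [Complex.sq_norm, Complex.normSq_apply]
  simp only [sub_re, sub_im, mul_re, mul_im, conj_re, conj_im, one_re, one_im] at *
  nlinarith [mul_pos (sub_pos.2 ha2) (sub_pos.2 hw2)]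

/-- Moving the zero of a conformal equivalence onto the disc to a prescribed point. -/
theorem ConformalEquivOn.exists_mobius {φ : ℂ → ℂ} {U : Set ℂ}
    (hφ : ConformalEquivOn φ U (ball 0 1)) {t : ℂ} (ht : t ∈ U) :
    ∃ ψ : ℂ → ℂ, ConformalEquivOn ψ U (ball 0 1) ∧ ψ t = 0 ∧
      ∀ z ∈ U, φ z - ψ z = φ t - conj (φ t) * (φ z * ψ z) := by
  obtain ⟨hd, hm, hi, hsurj⟩ := hφ
  have hn : ∀ z ∈ U, ‖φ z‖ < 1 := fun z hz => by simpa using hm hz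
  set a := φ t with ha_def
  have ha : ‖a‖ < 1 := hn t ht
  have hne : ∀ z ∈ U, 1 - conj a * φ z ≠ 0 := fun z hz => one_sub_conj_mul_ne_zero ha (hn z hz)
  have key : ∀ z ∈ U, φ z - (φ z - a) / (1 - conj a * φ z) =
      a - conj a * (φ z * ((φ z - a) / (1 - conj a * φ z))) := fun z hz => by
    have hv := div_mul_cancel₀ (φ z - a) (hne z hz)
    generalize (φ z - a) / (1 - conj a * φ z) = v at hv ⊢
    linear_combination -hv
  refine ⟨fun z => (φ z - a) / (1 - conj a * φ z), ⟨?_, ?_, ?_, ?_⟩, ?_, key⟩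
  · exact (hd.sub_const a).div ((hd.const_mul _).const_sub 1) hne
  · intro z hz
    simpa using norm_sub_div_one_sub_conj_mul_lt_one ha (hn z hz)
  · intro x hx y hy hxy
    refine hi hx hy ?_
    have kx := key x hx
    have ky := key y hy
    simp only at hxy
    rw [hxy] at kx
    have hv := norm_sub_div_one_sub_conj_mul_lt_one ha (hn y hy)
    generalize (φ y - a) / (1 - conj a * φ y) = v at *
    have h1 : 1 - conj (-a) * v ≠ 0 := one_sub_conj_mul_ne_zero (by simpa using ha) hv
    refine mul_right_cancel₀ h1 ?_
    simp only [map_neg]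
    linear_combination kx - ky
  · intro v hv
    have hv1 : ‖v‖ < 1 := by simpa using hv
    have ha' : ‖-a‖ < 1 := by simpa using ha
    have h1 := one_sub_conj_mul_ne_zero ha' hv1
    have h2 := norm_sub_div_one_sub_conj_mul_lt_one ha' hv1
    obtain ⟨z, hz, hzv⟩ := hsurj (show (v - -a) / (1 - conj (-a) * v) ∈ ball (0 : ℂ) 1 by
      simpa using h2)
    refine ⟨z, hz, ?_⟩
    have h3 := hne z hz
    have h4 : φ z * (1 - conj (-a) * v) = v - -a := by rw [hzv, div_mul_cancel₀ _ h1]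
    simp only [map_neg] at h4
    change (φ z - a) / (1 - conj a * φ z) = v
    rw [div_eq_iff h3]
    linear_combination h4
  · simp [← ha_def]

theorem ConformalEquivOn.analyticOrderAt_eq_one {φ : ℂ → ℂ} {U V : Set ℂ} (hU : IsOpen U)
    (hφ : ConformalEquivOn φ U V) {s : ℂ} (hs : s ∈ U) (h0 : φ s = 0) :
    analyticOrderAt φ s = 1 :=
  (hφ.1.analyticAt (hU.mem_nhds hs)).analyticOrderAt_eq_one_of_zero_deriv_ne_zero h0
    (deriv_ne_zero_of_injOn hU hφ.1 hφ.2.injOn hs)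

namespace KaltonSpace

variable {U : Set ℂ} {Sig F : Type*}
  [NormedAddCommGroup Sig] [NormedSpace ℂ Sig] [CompleteSpace Sig]
  [NormedAddCommGroup F] [NormedSpace ℂ F] [CompleteSpace F]

theorem analyticAt (K : KaltonSpace U Sig F) (f : F) {z : ℂ} (hz : z ∈ U) :
    AnalyticAt ℂ (K.toFun f) z :=
  (K.analytic f).analyticAt (K.isOpen.mem_nhds hz)

/-- Multiplication by a conformal equivalence is a linear isometry of a Kalton space. -/
theorem exists_mul_isometry (K : KaltonSpace U Sig F) {φ : ℂ → ℂ}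
    (hφ : ConformalEquivOn φ U (ball 0 1)) :
    ∃ T : F →ₗᵢ[ℂ] F, ∀ f, ∀ z ∈ U, K.toFun (T f) z = φ z • K.toFun f z := by
  choose T hT hTn using K.conf_mul_mem φ hφ
  refine ⟨⟨⟨⟨T, fun f g => K.inj _ _ fun z hz => ?_⟩, fun c f => K.inj _ _ fun z hz => ?_⟩, hTn⟩,
    hT⟩
  · simp [hT _ z hz]
  · simp [hT _ z hz, smul_comm c]

theorem exists_div (K : KaltonSpace U Sig F) {φ : ℂ → ℂ}
    (hφ : ConformalEquivOn φ U (ball 0 1)) {s : ℂ} (hs : s ∈ U) (h0 : φ s = 0) {f : F}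
    (hf : K.toFun f s = 0) :
    ∃ h : F, (∀ z ∈ U, K.toFun f z = φ z • K.toFun h z) ∧ ‖h‖ = ‖f‖ := by
  have hnhds : U ∈ 𝓝 s := K.isOpen.mem_nhds hs
  have hne : ∀ z ∈ U, dslope φ s z ≠ 0 := by
    intro z hz
    rcases eq_or_ne z s with rfl | hzs
    · rw [dslope_same]
      exact deriv_ne_zero_of_injOn K.isOpen hφ.1 hφ.2.injOn hs
    · rw [dslope_of_ne _ hzs, slope_def_field, h0, sub_zero]
      refine div_ne_zero (fun h => hzs (hφ.2.injOn hz hs (h.trans h0.symm))) (sub_ne_zero.2 hzs)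
  have hfac : ∀ z ∈ U, K.toFun f z = φ z • (dslope φ s z)⁻¹ • dslope (K.toFun f) s z := by
    intro z hz
    have h1 := sub_smul_dslope φ s z
    have h2 := sub_smul_dslope (K.toFun f) s z
    rw [h0, sub_zero, smul_eq_mul] at h1
    rw [hf, sub_zero] at h2
    rw [← h1, ← h2, smul_smul, mul_assoc, mul_inv_cancel₀ (hne z hz), mul_one]
  obtain ⟨h, hh, hn⟩ := K.conf_div_mem φ hφ
    (fun z => (dslope φ s z)⁻¹ • dslope (K.toFun f) s z)
    ((((Complex.differentiableOn_dslope hnhds).2 hφ.1).inv hne).smul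
      ((Complex.differentiableOn_dslope hnhds).2 (K.analytic f))) f hfac
  exact ⟨h, fun z hz => by rw [hh z hz, ← hfac z hz], hn⟩

theorem analyticOrderAt_of_eq_smul (K : KaltonSpace U Sig F) {φ : ℂ → ℂ}
    (hφ : ConformalEquivOn φ U (ball 0 1)) {s : ℂ} (hs : s ∈ U) (h0 : φ s = 0) {f h : F}
    (hfh : ∀ z ∈ U, K.toFun f z = φ z • K.toFun h z) :
    analyticOrderAt (K.toFun f) s = 1 + analyticOrderAt (K.toFun h) s := by
  have hnhds : U ∈ 𝓝 s := K.isOpen.mem_nhds hs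
  rw [← hφ.analyticOrderAt_eq_one K.isOpen hs h0,
    ← analyticOrderAt_smul (hφ.1.analyticAt hnhds) (K.analyticAt h hs)]
  exact analyticOrderAt_congr (by filter_upwards [hnhds] with z hz using hfh z hz)

/-- Replacing a zero of order `m` at `s` by one at `t`. -/
theorem exists_move_zero (K : KaltonSpace U Sig F) {φ ψ : ℂ → ℂ}
    (hφ : ConformalEquivOn φ U (ball 0 1)) (hψ : ConformalEquivOn ψ U (ball 0 1))
    {s t : ℂ} (hs : s ∈ U) (ht : t ∈ U) (hφs : φ s = 0) (hψt : ψ t = 0) {c : ℝ}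
    (hc : ∀ f g h : F, (∀ z ∈ U, K.toFun f z = φ z • K.toFun h z) →
      (∀ z ∈ U, K.toFun g z = ψ z • K.toFun h z) → ‖f - g‖ ≤ c * ‖h‖) (m : ℕ) :
    ∀ f : F, (m : ℕ∞) ≤ analyticOrderAt (K.toFun f) s →
      ∃ g : F, (m : ℕ∞) ≤ analyticOrderAt (K.toFun g) t ∧ ‖g‖ = ‖f‖ ∧
        ‖f - g‖ ≤ m * c * ‖f‖ := by
  obtain ⟨S, hS⟩ := K.exists_mul_isometry hφ
  obtain ⟨T, hT⟩ := K.exists_mul_isometry hψ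
  induction m with
  | zero => exact fun f _ => ⟨f, by simp⟩
  | succ m ih =>
    intro f hf
    have hfs : K.toFun f s = 0 := by
      refine apply_eq_zero_of_analyticOrderAt_ne_zero fun h => ?_
      rw [h] at hf
      simp at hf
    obtain ⟨h, hh, hn⟩ := K.exists_div hφ hs hφs hfs
    rw [K.analyticOrderAt_of_eq_smul hφ hs hφs hh, Nat.cast_add, Nat.cast_one,
      add_comm (1 : ℕ∞), ENat.add_le_add_iff_right ENat.one_ne_top] at hf
    obtain ⟨g, hg, hgn, hhg⟩ := ih h hf
    refine ⟨T g, ?_, by rw [T.norm_map, hgn, hn], ?_⟩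
    · rw [K.analyticOrderAt_of_eq_smul hψ ht hψt (hT g), Nat.cast_add, Nat.cast_one, add_comm]
      gcongr
    · have hfS : f = S h := K.inj _ _ fun z hz => by rw [hh z hz, hS h z hz]
      calc ‖f - T g‖ = ‖S (h - g) + (S g - T g)‖ := by rw [hfS, map_sub]; congr 1; abel
        _ ≤ ‖S (h - g)‖ + ‖S g - T g‖ := norm_add_le _ _
        _ ≤ m * c * ‖h‖ + c * ‖g‖ := by
          rw [S.norm_map]
          exact add_le_add hhg (hc _ _ g (hS g) (hT g))
        _ = ((m + 1 : ℕ) : ℝ) * c * ‖f‖ := by rw [hgn, hn]; push_cast; ring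

theorem setOf_iteratedDeriv_eq_zero (K : KaltonSpace U Sig F) {z : ℂ} (hz : z ∈ U) (n : ℕ) :
    {f : F | ∀ k ≤ n, iteratedDeriv k (K.toFun f) z = 0} =
      {f : F | ((n + 1 : ℕ) : ℕ∞) ≤ analyticOrderAt (K.toFun f) z} := by
  ext f
  simp only [mem_ofPred_eq,
    natCast_le_analyticOrderAt_iff_iteratedDeriv_eq_zero (K.analyticAt f hz), Nat.lt_succ_iff]

end KaltonSpace

theorem sSup_infDist_unitBall_le {Z : Type*} [SeminormedAddCommGroup Z] {M N : Set Z} {c : ℝ}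
    (hc : 0 ≤ c) (h : ∀ x ∈ M, ∃ y ∈ N, ‖y‖ = ‖x‖ ∧ ‖x - y‖ ≤ c * ‖x‖) :
    sSup ((fun x => infDist x (N ∩ closedBall 0 1)) '' (M ∩ closedBall 0 1)) ≤ c := by
  refine Real.sSup_le ?_ hc
  rintro _ ⟨x, ⟨hxM, hx⟩, rfl⟩
  rw [mem_closedBall_zero_iff] at hx
  obtain ⟨y, hyN, hyn, hxy⟩ := h x hxM
  calc infDist x (N ∩ closedBall 0 1) ≤ dist x y :=
        infDist_le_dist_of_mem ⟨hyN, by rwa [mem_closedBall_zero_iff, hyn]⟩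
    _ ≤ c * ‖x‖ := by rwa [dist_eq_norm]
    _ ≤ c := mul_le_of_le_one_right hc hx

/-- The gap, computed in `𝓕`, between the subspaces `⋂_{0 ≤ k ≤ n} ker δ_s^{(k)}` and
`⋂_{0 ≤ k ≤ n} ker δ_t^{(k)}` is at most `2(n+1)·h(s,t)`, where `h(s,t) = |φ_s(t)|` is the
pseudo-hyperbolic distance on `U`. -/
theorem statement3 (U : Set ℂ) (Sig F : Type*)
    [NormedAddCommGroup Sig] [NormedSpace ℂ Sig] [CompleteSpace Sig]
    [NormedAddCommGroup F] [NormedSpace ℂ F] [CompleteSpace F]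
    (K : KaltonSpace U Sig F) (s t : ℂ) (hs : s ∈ U) (ht : t ∈ U) (n : ℕ)
    (φs : ℂ → ℂ) (hφ : ConformalEquivOn φs U (Metric.ball (0 : ℂ) 1)) (hφs : φs s = 0) :
    subGap {f : F | ∀ k ≤ n, iteratedDeriv k (K.toFun f) s = 0}
        {f : F | ∀ k ≤ n, iteratedDeriv k (K.toFun f) t = 0} ≤
      2 * (n + 1 : ℝ) * ‖φs t‖ := by
  obtain ⟨ψ, hψ, hψt, hφψ⟩ := hφ.exists_mobius ht
  have hdiff : ∀ f g h : F, (∀ z ∈ U, K.toFun f z = φs z • K.toFun h z) →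
      (∀ z ∈ U, K.toFun g z = ψ z • K.toFun h z) → ‖f - g‖ ≤ 2 * ‖φs t‖ * ‖h‖ := by
    intro f g h hf hg
    obtain ⟨k, hk, hkn⟩ := K.conf_mul_mem φs hφ g
    obtain ⟨g', hg', hg'n⟩ := K.conf_mul_mem ψ hψ h
    obtain rfl : g' = g := K.inj _ _ fun z hz => by rw [hg' z hz, hg z hz]
    have heq : f - g' = φs t • h - conj (φs t) • k := K.inj _ _ fun z hz => by
      simp only [map_sub, map_smul, Pi.sub_apply, Pi.smul_apply, hf z hz, hk z hz, hg z hz,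
        smul_smul, ← sub_smul, hφψ z hz]
    calc ‖f - g'‖ ≤ ‖φs t • h‖ + ‖conj (φs t) • k‖ := heq ▸ norm_sub_le _ _
      _ = 2 * ‖φs t‖ * ‖h‖ := by
        rw [norm_smul, norm_smul, RCLike.norm_conj, hkn, hg'n]
        ring
  have hc : 0 ≤ 2 * (n + 1 : ℝ) * ‖φs t‖ := by positivity
  have hcn : ((n + 1 : ℕ) : ℝ) * (2 * ‖φs t‖) = 2 * (n + 1 : ℝ) * ‖φs t‖ := by
    push_cast
    ring
  rw [K.setOf_iteratedDeriv_eq_zero hs, K.setOf_iteratedDeriv_eq_zero ht]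
  refine max_le (sSup_infDist_unitBall_le hc ?_) (sSup_infDist_unitBall_le hc ?_)
  · rw [← hcn]
    exact K.exists_move_zero hφ hψ hs ht hφs hψt hdiff (n + 1)
  · rw [← hcn]
    exact K.exists_move_zero hψ hφ ht hs hψt hφs
      (fun f g h hf hg => norm_sub_rev g f ▸ hdiff g f h hg hf) (n + 1)
end
end

section
/- Let 0 ≤ θ₀ < θ₁ < θ₂ < 2π, with arcs A₀ = [θ₀, θ₁), A₁ = [θ₁, θ₂), A₂ = [θ₂, θ₀ + 2π), and set α_j = (1/2π)·(length of A_j) and β_j = (1/2π)·∫_{A_j} e^{−it} dt for j = 0, 1, 2. Then there exist real numbers a₀, a₁, a₂ with a₀α₀ + a₁α₁ + a₂α₂ = 0 and a₀β₀ + a₁β₁ + a₂β₂ = −1, and there exist real numbers b₀, b₁, b₂ with b₀α₀ + b₁α₁ + b₂α₂ = 0 and b₀β₀ + b₁β₁ + b₂β₂ = −i. -/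
open Real Complex

noncomputable section

theorem integral_exp_neg_mul_I (u v : ℝ) :
    ∫ t in u..v, Complex.exp (-(↑t * Complex.I)) =
      ((Real.sin v - Real.sin u : ℝ) : ℂ) + ((Real.cos v - Real.cos u : ℝ) : ℂ) * Complex.I := by
  have h : ∀ t : ℝ, Complex.exp (-(↑t * Complex.I)) = Complex.exp (-Complex.I * t) := fun t => by
    ring_nf
  have he : ∀ t : ℝ, Complex.exp (-Complex.I * t) =
      (Real.cos t : ℂ) - (Real.sin t : ℂ) * Complex.I := fun t => by
    rw [show -Complex.I * (t : ℂ) = (-(t : ℂ)) * Complex.I by ring, Complex.exp_mul_I,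
      Complex.cos_neg, Complex.sin_neg]
    push_cast
    ring
  simp only [h]
  rw [integral_exp_mul_complex (neg_ne_zero.mpr Complex.I_ne_zero), he, he,
    div_eq_iff (neg_ne_zero.mpr Complex.I_ne_zero)]
  push_cast
  linear_combination (Complex.cos v - Complex.cos u) * Complex.I_mul_I

/-- Twice the signed area of the triangle with vertices at angles `2x, 2y, 2z` on the unit circle. -/
theorem circle_triangle_area (x y z : ℝ) :
    (Real.sin (2 * y) - Real.sin (2 * x)) * (Real.cos (2 * z) - Real.cos (2 * y)) -
      (Real.sin (2 * z) - Real.sin (2 * y)) * (Real.cos (2 * y) - Real.cos (2 * x)) =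
    -(4 * Real.sin (y - x) * Real.sin (z - y) * Real.sin (z - x)) := by
  have h := Real.sin_sub ((2 * z + 2 * y) / 2) ((2 * y + 2 * x) / 2)
  rw [show (2 * z + 2 * y) / 2 - (2 * y + 2 * x) / 2 = z - x by ring] at h
  rw [Real.sin_sub_sin, Real.sin_sub_sin, Real.cos_sub_cos, Real.cos_sub_cos, h,
    show (2 * y - 2 * x) / 2 = y - x by ring, show (2 * z - 2 * y) / 2 = z - y by ring]
  ring

theorem circle_triangle_area_ne_zero {r s t : ℝ} (hrs : r < s) (hst : s < t)
    (htr : t < r + 2 * π) :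
    (Real.sin s - Real.sin r) * (Real.cos t - Real.cos s) -
      (Real.sin t - Real.sin s) * (Real.cos s - Real.cos r) ≠ 0 := by
  have h := circle_triangle_area (r / 2) (s / 2) (t / 2)
  simp only [mul_div_cancel₀ _ (two_ne_zero' ℝ)] at h
  rw [h]
  have h1 : 0 < Real.sin (s / 2 - r / 2) := Real.sin_pos_of_pos_of_lt_pi (by linarith) (by linarith)
  have h2 : 0 < Real.sin (t / 2 - s / 2) := Real.sin_pos_of_pos_of_lt_pi (by linarith) (by linarith)
  have h3 : 0 < Real.sin (t / 2 - r / 2) := Real.sin_pos_of_pos_of_lt_pi (by linarith) (by linarith)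
  exact neg_ne_zero.mpr (by positivity)

/-- If `α` sums to one, `β` sums to zero and `β 0, β 1` are linearly independent over `ℝ`, then
every `w` is a real combination of `β` whose coefficients are orthogonal to `α`. -/
theorem exists_real_combination (α : Fin 3 → ℝ) (β : Fin 3 → ℂ) (hα : ∑ j, α j = 1)
    (hβ : ∑ j, β j = 0) (hD : (β 0).re * (β 1).im - (β 1).re * (β 0).im ≠ 0) (w : ℂ) :
    ∃ a : Fin 3 → ℝ, (∑ j, a j * α j) = 0 ∧ (∑ j, (a j : ℂ) * β j) = w := by
  obtain ⟨p, q, hp, hq⟩ : ∃ p q : ℝ, p * (β 0).re + q * (β 1).re = w.re ∧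
      p * (β 0).im + q * (β 1).im = w.im := by
    refine ⟨(w.re * (β 1).im - w.im * (β 1).re) / ((β 0).re * (β 1).im - (β 1).re * (β 0).im),
      ((β 0).re * w.im - (β 0).im * w.re) / ((β 0).re * (β 1).im - (β 1).re * (β 0).im), ?_, ?_⟩
    all_goals
      rw [div_mul_eq_mul_div, div_mul_eq_mul_div, ← add_div, div_eq_iff hD]
      ring
  have hw : (p : ℂ) * β 0 + q * β 1 = w := by
    apply Complex.ext <;> simp [hp, hq]
  rw [Fin.sum_univ_three] at hα hβ
  refine ⟨![p - (p * α 0 + q * α 1), q - (p * α 0 + q * α 1), -(p * α 0 + q * α 1)], ?_, ?_⟩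
  · simp only [Fin.sum_univ_three, Matrix.cons_val]
    linear_combination -(p * α 0 + q * α 1) * hα
  · simp only [Fin.sum_univ_three, Matrix.cons_val]
    push_cast
    linear_combination hw - ((p : ℂ) * α 0 + q * α 1) * hβ

/-- For a partition of the circle into three arcs `A₀ = [θ₀,θ₁)`, `A₁ = [θ₁,θ₂)`,
`A₂ = [θ₂, θ₀+2π)`, with `α_j = (1/2π)·length(A_j)` and `β_j = (1/2π)∫_{A_j} e^{-it} dt`,
there are real numbers `a₀,a₁,a₂` with `Σ aⱼαⱼ = 0` and `Σ aⱼβⱼ = -1`, and real numbers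
`b₀,b₁,b₂` with `Σ bⱼαⱼ = 0` and `Σ bⱼβⱼ = -i`. -/
theorem statement11 (θ₀ θ₁ θ₂ : ℝ)
    (h0 : 0 ≤ θ₀) (h01 : θ₀ < θ₁) (h12 : θ₁ < θ₂) (h2 : θ₂ < 2 * π)
    (α : Fin 3 → ℝ) (β : Fin 3 → ℂ)
    (hα : α = ![(θ₁ - θ₀) / (2 * π), (θ₂ - θ₁) / (2 * π), (θ₀ + 2 * π - θ₂) / (2 * π)])
    (hβ : β = ![(1 / (2 * π) : ℂ) * ∫ t in θ₀..θ₁, Complex.exp (-(↑t * Complex.I)),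
                (1 / (2 * π) : ℂ) * ∫ t in θ₁..θ₂, Complex.exp (-(↑t * Complex.I)),
                (1 / (2 * π) : ℂ) * ∫ t in θ₂..(θ₀ + 2 * π), Complex.exp (-(↑t * Complex.I))]) :
    (∃ a : Fin 3 → ℝ, (∑ j, a j * α j) = 0 ∧ (∑ j, (a j : ℂ) * β j) = -1) ∧
    (∃ b : Fin 3 → ℝ, (∑ j, b j * α j) = 0 ∧ (∑ j, (b j : ℂ) * β j) = -Complex.I) := by
  have hπ : (2 * π) ≠ 0 := by positivity
  have hc : (1 / (2 * π) : ℂ) = ((1 / (2 * π) : ℝ) : ℂ) := by push_cast; rfl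
  simp only [integral_exp_neg_mul_I, Real.sin_add_two_pi, Real.cos_add_two_pi, hc] at hβ
  have hα1 : ∑ j, α j = 1 := by
    simp only [hα, Fin.sum_univ_three, Matrix.cons_val]
    field_simp
    ring
  have hβ0 : ∑ j, β j = 0 := by
    simp only [hβ, Fin.sum_univ_three, Matrix.cons_val]
    push_cast
    ring
  have hD : (β 0).re * (β 1).im - (β 1).re * (β 0).im ≠ 0 := by
    have h := mul_ne_zero (pow_ne_zero 2 (one_div_ne_zero hπ))
      (circle_triangle_area_ne_zero h01 h12 (by linarith))
    convert h using 1
    simp only [hβ, Matrix.cons_val, Complex.re_ofReal_mul, Complex.im_ofReal_mul, Complex.add_re,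
      Complex.add_im, Complex.ofReal_re, Complex.ofReal_im, Complex.I_re, Complex.I_im]
    ring
  exact ⟨exists_real_combination α β hα1 hβ0 hD _, exists_real_combination α β hα1 hβ0 hD _⟩
end
end
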